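/- arXiv:1909.08877 — 3 statements merged into one kernel-verified Lean document; each statement's English description precedes it below -/
import Mathlib

section
/- Let M be a model of Vaught set theory VS. Then the class PC₁ is closed under ∼: for all x, y ∈ M, if PC₁(x) and x ∼ y, then PC₁(y). Moreover, if PC₁(x) and f : x ∼ y, then PC₁(f). -/
/-!
Vaught set theory `VS`, semantically: a type `M` with a membership relation `mem`
satisfying (VS1) an empty set exists and (VS2ₙ, n ≥ 1) every nonempty finite
collection of elements is the extension of some element.
-/

namespace VS

variable {M : Type*}

/-- `p` is a (Kuratowski) pair-representative of `(u, v)`. -/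
def IsPairRep (mem : M → M → Prop) (p u v : M) : Prop :=
  ∃ a b : M, (∀ z, mem z p ↔ (z = a ∨ z = b)) ∧ (∀ z, mem z a ↔ z = u) ∧
    (∀ z, mem z b ↔ (z = u ∨ z = v))

/-- `f` is a function: all of its elements are pair-representatives, and any two
elements of `f` with the same first component are equal. -/
def IsFunc (mem : M → M → Prop) (f : M) : Prop :=
  (∀ w, mem w f → ∃ u v, IsPairRep mem w u v) ∧
  (∀ w w' u v u' v', mem w f → mem w' f → IsPairRep mem w u v → IsPairRep mem w' u' v' →
    u = u' → w = w')

/-- `f : x ∼ y`: `f` is a bijection between `x` and `y`. -/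
def IsBij (mem : M → M → Prop) (f x y : M) : Prop :=
  IsFunc mem f ∧
  (∀ w u v, mem w f → IsPairRep mem w u v → mem u x ∧ mem v y) ∧
  (∀ u, mem u x → ∃ w v, mem w f ∧ IsPairRep mem w u v) ∧
  (∀ v, mem v y → ∃ w u, mem w f ∧ IsPairRep mem w u v) ∧
  (∀ w w' u v u' v', mem w f → mem w' f → IsPairRep mem w u v → IsPairRep mem w' u' v' →
    v = v' → w = w')

/-- `x ∼ y`: there is a bijection between `x` and `y`. -/
def Sim (mem : M → M → Prop) (x y : M) : Prop := ∃ f, IsBij mem f x y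

/-- The class `PC₀`. -/
def PC0 (mem : M → M → Prop) (x : M) : Prop :=
  Sim mem x x ∧ (∀ y z, Sim mem x y → Sim mem x z → Sim mem y z) ∧
  (∀ y z, Sim mem x y → Sim mem y z → Sim mem x z)

/-- The class `PC₁`. -/
def PC1 (mem : M → M → Prop) (x : M) : Prop :=
  PC0 mem x ∧ ∀ u v f, Sim mem x u → Sim mem u v → IsBij mem f u v → Sim mem u f

/-- The reinterpreted membership relation `∈⁺`: `u ∈⁺ v` iff `u ∈ v` and `PC₁(v)`. -/
def memPlus (mem : M → M → Prop) (u v : M) : Prop := mem u v ∧ PC1 mem v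

/-- The axioms of Vaught set theory `VS`: (VS1) there is an empty set, and
(VS2ₙ for n ≥ 1) any nonempty finite list of elements is the extension of some element. -/
def VSAx (mem : M → M → Prop) : Prop :=
  (∃ x, ∀ y, ¬ mem y x) ∧
  (∀ l : List M, l ≠ [] → ∃ x, ∀ y, mem y x ↔ y ∈ l)

end VS

namespace VS

variable {M : Type*} {mem : M → M → Prop} {x y : M}

lemma PC0.of_sim (hx : PC0 mem x) (hxy : Sim mem x y) : PC0 mem y := by
  obtain ⟨-, euclid, trans⟩ := hx
  exact ⟨euclid y y hxy hxy,
    fun u v hu hv => euclid u v (trans y u hxy hu) (trans y v hxy hv),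
    fun u v hu huv => euclid y v hxy (trans u v (trans y u hxy hu) huv)⟩

lemma PC1.of_sim (hx : PC1 mem x) (hxy : Sim mem x y) : PC1 mem y :=
  ⟨hx.1.of_sim hxy, fun u v f hu => hx.2 u v f (hx.1.2.2 y u hxy hu)⟩

lemma PC1.of_isBij {f : M} (hx : PC1 mem x) (hf : IsBij mem f x y) : PC1 mem f :=
  hx.of_sim (hx.2 x y f hx.1.1 ⟨f, hf⟩ hf)

end VS

open VS in
/-- In a model of `VS`, the class `PC₁` is closed under `∼`; moreover, if `PC₁(x)`
and `f : x ∼ y`, then `PC₁(f)`. -/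
theorem PC1_closed_under_sim {M : Type*} (mem : M → M → Prop) (h : VSAx mem) :
    (∀ x y : M, PC1 mem x → Sim mem x y → PC1 mem y) ∧
    (∀ x y f : M, PC1 mem x → IsBij mem f x y → PC1 mem f) :=
  ⟨fun _ _ hx hxy => hx.of_sim hxy, fun _ _ _ hx hf => hx.of_isBij hf⟩
end

section
/- Let M be a model of Vaught set theory VS. Then every element of M with only finitely many ∈-elements satisfies PC₁. (In particular, finite sets are absolute with respect to the reinterpretation u ∈⁺ v :⇔ u ∈ v ∧ PC₁(v).) -/
namespace VS

variable {M : Type*} {mem : M → M → Prop}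

/-- The components of a pair-representative are unique, even without extensionality. -/
theorem IsPairRep.unique {p u v u' v' : M} (hp : IsPairRep mem p u v)
    (hp' : IsPairRep mem p u' v') : u = u' ∧ v = v' := by
  obtain ⟨a, b, hab, ha, hb⟩ := hp
  obtain ⟨a', b', hab', ha', hb'⟩ := hp'
  have ha_mem : a = a' ∨ a = b' := (hab' a).1 ((hab a).2 (Or.inl rfl))
  have hb_mem : b = a' ∨ b = b' := (hab' b).1 ((hab b).2 (Or.inr rfl))
  have hb'_mem : b' = a ∨ b' = b := (hab b').1 ((hab' b').2 (Or.inr rfl))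
  have hu : u = u' := by
    rcases ha_mem with rfl | rfl
    · exact (ha' u).1 ((ha u).2 rfl)
    · exact ((ha u').1 ((hb' u').2 (Or.inl rfl))).symm
  subst hu
  refine ⟨rfl, ?_⟩
  have hv : mem v b := (hb v).2 (Or.inr rfl)
  have hv' : mem v' b' := (hb' v').2 (Or.inr rfl)
  rcases hb_mem with rfl | rfl
  · have hvu := (ha' v).1 hv
    rcases hb'_mem with rfl | rfl
    · exact hvu.trans ((ha v').1 hv').symm
    · exact hvu.trans ((ha' v').1 hv').symm
  · rcases (hb' v).1 hv with hvu | hvv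
    · rcases (hb v').1 hv' with h | h
      · exact hvu.trans h.symm
      · exact h.symm
    · exact hvv

theorem VSAx.exists_of_finite (h : VSAx mem) {s : Set M} (hs : s.Finite) :
    ∃ x, ∀ y, mem y x ↔ y ∈ s := by
  rcases s.eq_empty_or_nonempty with rfl | ⟨a, ha⟩
  · simpa using h.1
  · obtain ⟨x, hx⟩ := h.2 hs.toFinset.toList (by
      intro hl
      have : a ∈ hs.toFinset.toList := by simpa using ha
      simp [hl] at this)
    exact ⟨x, by simpa using hx⟩

theorem VSAx.exists_isPairRep (h : VSAx mem) (u v : M) : ∃ p, IsPairRep mem p u v := by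
  obtain ⟨a, ha⟩ := h.2 [u] (by simp)
  obtain ⟨b, hb⟩ := h.2 [u, v] (by simp)
  obtain ⟨p, hp⟩ := h.2 [a, b] (by simp)
  exact ⟨p, a, b, by simpa using hp, by simpa using ha, by simpa using hb⟩

/-- A bijection `f : x ∼ y` has as many elements as its domain `x`. -/
theorem IsBij.nonempty_equiv_left {f x y : M} (hf : IsBij mem f x y) :
    Nonempty ({w // mem w f} ≃ {u // mem u x}) := by
  obtain ⟨⟨hpair, hfun⟩, hmem, hdom, -, -⟩ := hf
  choose p q hpq using hpair
  refine ⟨Equiv.ofBijective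
    (fun w => ⟨p w.1 w.2, (hmem _ _ _ w.2 (hpq _ w.2)).1⟩) ⟨?_, ?_⟩⟩
  · intro w w' hww'
    exact Subtype.ext (hfun _ _ _ _ _ _ w.2 w'.2 (hpq _ _) (hpq _ _) (congrArg Subtype.val hww'))
  · rintro ⟨u, hu⟩
    obtain ⟨w, v, hw, hwuv⟩ := hdom u hu
    exact ⟨⟨w, hw⟩, Subtype.ext ((hpq w hw).unique hwuv).1⟩

/-- A bijection `f : x ∼ y` has as many elements as its range `y`. -/
theorem IsBij.nonempty_equiv_right {f x y : M} (hf : IsBij mem f x y) :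
    Nonempty ({w // mem w f} ≃ {v // mem v y}) := by
  obtain ⟨⟨hpair, -⟩, hmem, -, hran, hinj⟩ := hf
  choose p q hpq using hpair
  refine ⟨Equiv.ofBijective
    (fun w => ⟨q w.1 w.2, (hmem _ _ _ w.2 (hpq _ w.2)).2⟩) ⟨?_, ?_⟩⟩
  · intro w w' hww'
    exact Subtype.ext (hinj _ _ _ _ _ _ w.2 w'.2 (hpq _ _) (hpq _ _) (congrArg Subtype.val hww'))
  · rintro ⟨v, hv⟩
    obtain ⟨w, u, hw, hwuv⟩ := hran v hv
    exact ⟨⟨w, hw⟩, Subtype.ext ((hpq w hw).unique hwuv).2⟩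

theorem Sim.nonempty_equiv {x y : M} (hxy : Sim mem x y) :
    Nonempty ({u // mem u x} ≃ {v // mem v y}) := by
  obtain ⟨f, hf⟩ := hxy
  obtain ⟨e⟩ := hf.nonempty_equiv_left
  obtain ⟨e₂⟩ := hf.nonempty_equiv_right
  exact ⟨e.symm.trans e₂⟩

/-- An external bijection between the extensions of finite sets is represented internally. -/
theorem VSAx.sim_of_equiv (h : VSAx mem) {x y : M} [Finite {u // mem u x}]
    (e : {u // mem u x} ≃ {v // mem v y}) : Sim mem x y := by
  choose pr hpr using h.exists_isPairRep
  obtain ⟨f, hf⟩ := h.exists_of_finite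
    (Set.finite_range fun u : {u // mem u x} => pr u.1 (e u).1)
  have key : ∀ w u v, mem w f → IsPairRep mem w u v →
      ∃ s : {u // mem u x}, w = pr s.1 (e s).1 ∧ u = s.1 ∧ v = (e s).1 := by
    intro w u v hw hwuv
    obtain ⟨s, rfl⟩ := (hf w).1 hw
    exact ⟨s, rfl, hwuv.unique (hpr _ _)⟩
  refine ⟨f, ⟨?_, ?_⟩, ?_, ?_, ?_, ?_⟩
  · intro w hw
    obtain ⟨s, rfl⟩ := (hf w).1 hw
    exact ⟨_, _, hpr _ _⟩
  · intro w w' u v u' v' hw hw' hp hp' huu'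
    obtain ⟨s, rfl, rfl, rfl⟩ := key _ _ _ hw hp
    obtain ⟨t, rfl, rfl, rfl⟩ := key _ _ _ hw' hp'
    rw [Subtype.ext huu']
  · intro w u v hw hp
    obtain ⟨s, rfl, rfl, rfl⟩ := key _ _ _ hw hp
    exact ⟨s.2, (e s).2⟩
  · intro u hu
    exact ⟨_, _, (hf _).2 ⟨⟨u, hu⟩, rfl⟩, hpr _ _⟩
  · intro v hv
    refine ⟨_, (e.symm ⟨v, hv⟩).1, (hf _).2 ⟨e.symm ⟨v, hv⟩, rfl⟩, ?_⟩
    simpa using hpr (e.symm ⟨v, hv⟩).1 v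
  · intro w w' u v u' v' hw hw' hp hp' hvv'
    obtain ⟨s, rfl, rfl, rfl⟩ := key _ _ _ hw hp
    obtain ⟨t, rfl, rfl, rfl⟩ := key _ _ _ hw' hp'
    rw [e.injective (Subtype.ext hvv')]

end VS

open VS in
/-- In a model of `VS`, every element with only finitely many `∈`-elements satisfies `PC₁`. -/
theorem PC1_of_finite {M : Type*} (mem : M → M → Prop) (h : VSAx mem)
    (x : M) (hfin : {y | mem y x}.Finite) :
    PC1 mem x := by
  have : Finite {y // mem y x} := hfin
  refine ⟨⟨h.sim_of_equiv (Equiv.refl _), ?_, ?_⟩, ?_⟩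
  · intro y z hxy hxz
    obtain ⟨e⟩ := hxy.nonempty_equiv
    obtain ⟨e₂⟩ := hxz.nonempty_equiv
    have := Finite.of_equiv _ e
    exact h.sim_of_equiv (e.symm.trans e₂)
  · intro y z hxy hyz
    obtain ⟨e⟩ := hxy.nonempty_equiv
    obtain ⟨e₂⟩ := hyz.nonempty_equiv
    exact h.sim_of_equiv (e.trans e₂)
  · intro u v f hxu _ hf
    obtain ⟨e⟩ := hxu.nonempty_equiv
    obtain ⟨e₂⟩ := hf.nonempty_equiv_left
    have := Finite.of_equiv _ e
    exact h.sim_of_equiv e₂.symm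
end

section
/- The finite theory A_W axiomatizes the complete theory W = Th(𝔑): for every L₀-sentence φ, every model of A_W satisfies φ if and only if 𝔑 ⊨ φ. Equivalently, every model of A_W is elementarily equivalent to 𝔑, so W is a finitely axiomatizable complete theory. -/
open FirstOrder FirstOrder.Language

/-- The language `L₀` with a constant `0`, a unary function `S`, and a binary relation `<`. -/
def L0 : FirstOrder.Language where
  Functions n := match n with
    | 0 => Unit
    | 1 => Unit
    | _ => Empty
  Relations n := match n with
    | 2 => Unit
    | _ => Empty

/-- The standard structure `𝔑 = (ℕ; 0, n ↦ n + 1, <)`. -/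
instance natL0 : L0.Structure ℕ where
  funMap {n} f x :=
    match n, f with
    | 0, _ => 0
    | 1, _ => x 0 + 1
  RelMap {n} r x :=
    match n, r with
    | 2, _ => x 0 < x 1

/-- The atomic formula `t₁ < t₂`. -/
def ltF {n : ℕ} (t₁ t₂ : L0.Term (Empty ⊕ Fin n)) : L0.BoundedFormula Empty n :=
  Relations.boundedFormula₂ (show L0.Relations 2 from Unit.unit) t₁ t₂

/-- The term `0`. -/
def zeroT {α : Type} : L0.Term α := Constants.term (show L0.Constants from Unit.unit)

/-- The term `S t`. -/
def succT {α : Type} (t : L0.Term α) : L0.Term α :=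
  Functions.apply₁ (show L0.Functions 1 from Unit.unit) t

/-- `<` is irreflexive. -/
def axIrrefl : L0.Sentence := ∀' ∼(ltF &0 &0)

/-- `<` is transitive. -/
def axTrans : L0.Sentence := ∀' ∀' ∀' ((ltF &0 &1 ⊓ ltF &1 &2) ⟹ ltF &0 &2)

/-- `<` is total: `∀x∀y (x < y ∨ x = y ∨ y < x)`. -/
def axTotal : L0.Sentence := ∀' ∀' (ltF &0 &1 ⊔ (Term.bdEqual &0 &1) ⊔ ltF &1 &0)

/-- `∀x ¬(x < 0)`. -/
def axZero : L0.Sentence := ∀' ∼(ltF &0 zeroT)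

/-- `∀x (x < S x ∧ ¬∃y (x < y ∧ y < S x))`. -/
def axSucc : L0.Sentence := ∀' (ltF &0 (succT &0) ⊓ ∼(∃' (ltF &0 &1 ⊓ ltF &1 (succT &0))))

/-- `∀x (x ≠ 0 → ∃y (S y = x))`. -/
def axPred : L0.Sentence := ∀' (∼(Term.bdEqual &0 zeroT) ⟹ ∃' (Term.bdEqual (succT &1) &0))

/-- The finite theory `A_W`. -/
def AW : L0.Theory := {axIrrefl, axTrans, axTotal, axZero, axSucc, axPred}

open Order

section BackAndForth

variable {M N : Type*} [LinearOrder M] [SuccOrder M] [LinearOrder N] [SuccOrder N]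

/-- The partial correspondence `A` between `M` and `N` preserves and reflects the order
of all successors of order at most `k`. -/
def OrderAgree (k : ℕ) (A : Set (M × N)) : Prop :=
  ∀ p ∈ A, ∀ q ∈ A, ∀ c ≤ k, ∀ d ≤ k,
    succ^[c] p.1 ≤ succ^[d] q.1 ↔ succ^[c] p.2 ≤ succ^[d] q.2

theorem OrderAgree.mono {k l : ℕ} (h : k ≤ l) {A : Set (M × N)} (hA : OrderAgree l A) :
    OrderAgree k A :=
  fun p hp q hq c hc d hd => hA p hp q hq c (hc.trans h) d (hd.trans h)

theorem OrderAgree.swap {k : ℕ} {A : Set (M × N)} (hA : OrderAgree k A) :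
    OrderAgree k (Prod.swap '' A) := by
  rintro _ ⟨p, hp, rfl⟩ _ ⟨q, hq, rfl⟩ c hc d hd
  exact (hA p hp q hq c hc d hd).symm

theorem OrderAgree.of_swap {k : ℕ} {A : Set (M × N)} {a : N} {b : M}
    (hA : OrderAgree k (insert (a, b) (Prod.swap '' A))) : OrderAgree k (insert (b, a) A) := by
  have := hA.swap
  rwa [Set.image_insert_eq, Set.image_image, Prod.swap_prod_mk,
    show (fun x : M × N => x.swap.swap) = id from rfl, Set.image_id] at this

theorem iterate_succ_lt_of_ne {k : ℕ} {x y : M} (hxy : x < y)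
    (h : ∀ d ≤ k, succ^[d] x ≠ y) : succ^[k] x < y := by
  induction k with
  | zero => exact hxy
  | succ k ih =>
    refine lt_of_le_of_ne ?_ (h _ le_rfl)
    rw [Function.iterate_succ_apply']
    exact succ_le_of_lt (ih fun d hd => h d (hd.trans k.le_succ))

variable [NoMaxOrder M] [NoMaxOrder N]

theorem iterate_succ_le_iterate_succ_iff (n : ℕ) {x y : M} :
    succ^[n] x ≤ succ^[n] y ↔ x ≤ y :=
  (succ_strictMono.iterate n).le_iff_le

theorem iterate_succ_le_iterate_succ_self_iff {c d : ℕ} {x : M} :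
    succ^[c] x ≤ succ^[d] x ↔ c ≤ d :=
  (strictMono_nat_of_lt_succ (f := fun n => succ^[n] x) fun n => by
    simp only [Function.iterate_succ_apply', lt_succ]).le_iff_le

theorem iterate_succ_lt_iterate_succ {k : ℕ} {x y : M} (hxy : succ^[k] x < y) {c d : ℕ}
    (hd : d ≤ k) : succ^[d] x < succ^[c] y :=
  ((iterate_succ_le_iterate_succ_self_iff.2 hd).trans_lt hxy).trans_le
    ((iterate_succ_le_iterate_succ_self_iff (c := 0)).2 c.zero_le)

theorem exists_iterate_succ_eq [OrderBot M] (hpred : ∀ x : M, x ≠ ⊥ → ∃ y, succ y = x)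
    {n : ℕ} {x : M} (h : succ^[n] ⊥ ≤ x) : ∃ y, succ^[n] y = x := by
  induction n generalizing x with
  | zero => exact ⟨x, rfl⟩
  | succ n ih =>
    rw [Function.iterate_succ_apply'] at h
    obtain ⟨z, rfl⟩ := hpred x (bot_le.trans_lt (succ_le_iff.1 h)).ne'
    obtain ⟨y, rfl⟩ := ih (succ_le_succ_iff.1 h)
    exact ⟨y, Function.iterate_succ_apply' ..⟩

theorem OrderAgree.insert_of_forall {k : ℕ} {A : Set (M × N)} (hA : OrderAgree k A) {a : M} {b : N}
    (h : ∀ p ∈ A, ∀ c ≤ k, ∀ d ≤ k,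
      (succ^[c] a ≤ succ^[d] p.1 ↔ succ^[c] b ≤ succ^[d] p.2) ∧
      (succ^[d] p.1 ≤ succ^[c] a ↔ succ^[d] p.2 ≤ succ^[c] b)) :
    OrderAgree k (insert (a, b) A) := by
  rintro p (rfl | hp) q (rfl | hq) c hc d hd
  · simp only [iterate_succ_le_iterate_succ_self_iff]
  · exact (h q hq c hc d hd).1
  · exact (h p hp d hd c hc).2
  · exact hA p hp q hq c hc d hd

theorem OrderAgree.exists_insert_of_iterate_eq [OrderBot M] [OrderBot N]
    (hpred : ∀ x : N, x ≠ ⊥ → ∃ y, succ y = x) {k : ℕ} {A : Set (M × N)}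
    (hA : OrderAgree (2 * k + 1) A) (hbot : (⊥, ⊥) ∈ A) {a : M} {q : M × N} (hq : q ∈ A)
    {c d : ℕ} (hc : c ≤ k) (hd : d ≤ k) (h : succ^[c] a = succ^[d] q.1) :
    ∃ b, OrderAgree k (insert (a, b) A) := by
  have hle : succ^[c] ⊥ ≤ succ^[d] q.1 :=
    h ▸ (iterate_succ_le_iterate_succ_iff c).2 bot_le
  obtain ⟨b, hb⟩ := exists_iterate_succ_eq hpred
    ((hA _ hbot q hq c (by omega) d (by omega)).1 hle)
  refine ⟨b, (hA.mono (by omega)).insert_of_forall fun p hp e he g hg => ?_⟩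
  have ha (e : ℕ) : succ^[c] (succ^[e] a) = succ^[e + d] q.1 := by
    rw [← Function.iterate_add_apply, add_comm, Function.iterate_add_apply, h,
      ← Function.iterate_add_apply]
  have hb (e : ℕ) : succ^[c] (succ^[e] b) = succ^[e + d] q.2 := by
    rw [← Function.iterate_add_apply, add_comm, Function.iterate_add_apply, hb,
      ← Function.iterate_add_apply]
  constructor
  · rw [← iterate_succ_le_iterate_succ_iff c, ha, ← iterate_succ_le_iterate_succ_iff (M := N) c,
      hb, ← Function.iterate_add_apply, ← Function.iterate_add_apply]
    exact hA q hq p hp _ (by omega) _ (by omega)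
  · rw [← iterate_succ_le_iterate_succ_iff c, ha, ← iterate_succ_le_iterate_succ_iff (M := N) c,
      hb, ← Function.iterate_add_apply, ← Function.iterate_add_apply]
    exact hA p hp q hq _ (by omega) _ (by omega)

theorem OrderAgree.exists_insert_of_iterate_ne [OrderBot M] [OrderBot N]
    {k : ℕ} {A : Set (M × N)} (hfin : A.Finite)
    (hA : OrderAgree (2 * k + 1) A) (hbot : (⊥, ⊥) ∈ A) {a : M}
    (h : ∀ q ∈ A, ∀ c ≤ k, ∀ d ≤ k, succ^[c] a ≠ succ^[d] q.1) :
    ∃ b, OrderAgree k (insert (a, b) A) := by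
  have hbelow : ⊥ < a := bot_lt_iff_ne_bot.2 (h _ hbot 0 k.zero_le 0 k.zero_le)
  obtain ⟨m, ⟨hm, hma⟩, hmax⟩ := Set.exists_max_image {p ∈ A | p.1 < a} Prod.fst
    (hfin.subset (Set.sep_subset ..)) ⟨_, hbot, hbelow⟩
  have hgap : succ^[k + 1] m.1 ≤ a := by
    rw [Function.iterate_succ_apply']
    exact succ_le_of_lt (iterate_succ_lt_of_ne hma fun d hd => (h m hm 0 k.zero_le d hd).symm)
  refine ⟨succ^[k + 1] m.2, (hA.mono (by omega)).insert_of_forall fun p hp c hc d hd => ?_⟩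
  rcases lt_trichotomy p.1 a with hpa | hpa | hpa
  · have hlt := iterate_succ_lt_iterate_succ (c := c)
      (iterate_succ_lt_of_ne hpa fun e he => (h p hp 0 k.zero_le e he).symm) hd
    have hle : p.2 ≤ m.2 :=
      (hA p hp m hm 0 (Nat.zero_le _) 0 (Nat.zero_le _)).1 (hmax p ⟨hp, hpa⟩)
    have hlt' : succ^[d] p.2 < succ^[c] (succ^[k + 1] m.2) := by
      refine iterate_succ_lt_iterate_succ ?_ hd
      rw [Function.iterate_succ_apply', lt_succ_iff]
      exact (iterate_succ_le_iterate_succ_iff k).2 hle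
    simp only [hlt.le, hlt'.le, hlt.not_ge, hlt'.not_ge, and_self]
  · exact absurd hpa.symm (h p hp 0 k.zero_le 0 k.zero_le)
  · have hap := iterate_succ_lt_of_ne hpa fun e he => h p hp e he 0 k.zero_le
    have hlt := iterate_succ_lt_iterate_succ (c := d) hap hc
    have hlt' : succ^[c] (succ^[k + 1] m.2) < succ^[d] p.2 := by
      refine iterate_succ_lt_iterate_succ ?_ hc
      have : succ^[k + (k + 1)] m.1 < p.1 := by
        rw [Function.iterate_add_apply]
        exact ((iterate_succ_le_iterate_succ_iff k).2 hgap).trans_lt hap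
      rw [← Function.iterate_add_apply, ← not_le]
      rw [← not_le] at this
      exact (hA p hp m hm 0 (Nat.zero_le _) _ (by omega)).not.1 this
    simp only [hlt.le, hlt'.le, hlt.not_ge, hlt'.not_ge, and_self]

theorem OrderAgree.exists_insert [OrderBot M] [OrderBot N]
    (hpred : ∀ x : N, x ≠ ⊥ → ∃ y, succ y = x) {k : ℕ} {A : Set (M × N)} (hfin : A.Finite)
    (hA : OrderAgree (2 * k + 1) A) (hbot : (⊥, ⊥) ∈ A) (a : M) :
    ∃ b, OrderAgree k (insert (a, b) A) := by
  by_cases h : ∀ q ∈ A, ∀ c ≤ k, ∀ d ≤ k, succ^[c] a ≠ succ^[d] q.1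
  · exact hA.exists_insert_of_iterate_ne hfin hbot h
  · push Not at h
    obtain ⟨q, hq, c, hc, d, hd, h⟩ := h
    exact hA.exists_insert_of_iterate_eq hpred hbot hq hc hd h

end BackAndForth

/-- The symbols of `L0` are interpreted in `M` by the least element, the successor and the order,
and every element other than the least one is a successor. -/
structure IsDiscreteModel (M : Type*) [L0.Structure M] [LinearOrder M] [OrderBot M]
    [SuccOrder M] : Prop where
  funMap_zero : ∀ (f : L0.Functions 0) (x : Fin 0 → M), Structure.funMap f x = ⊥
  funMap_succ : ∀ (f : L0.Functions 1) (x : Fin 1 → M), Structure.funMap f x = succ (x 0)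
  relMap_lt : ∀ (r : L0.Relations 2) (x : Fin 2 → M), Structure.RelMap r x ↔ x 0 < x 1
  exists_succ_eq : ∀ x : M, x ≠ ⊥ → ∃ y, succ y = x

namespace IsDiscreteModel

variable {M N : Type*} [L0.Structure M] [LinearOrder M] [OrderBot M] [SuccOrder M]
  [L0.Structure N] [LinearOrder N] [OrderBot N] [SuccOrder N]

theorem exists_realize_term (hM : IsDiscreteModel M) (hN : IsDiscreteModel N) {α : Type*}
    (t : L0.Term α) : ∃ d : ℕ, ∀ (v : α → M) (w : α → N) (A : Set (M × N)), (⊥, ⊥) ∈ A →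
      (∀ i, (v i, w i) ∈ A) →
      ∃ p ∈ A, t.realize v = succ^[d] p.1 ∧ t.realize w = succ^[d] p.2 := by
  induction t with
  | var i => exact ⟨0, fun v w A _ h => ⟨_, h i, rfl, rfl⟩⟩
  | @func l f ts ih =>
    match l, f with
    | 0, f =>
      exact ⟨0, fun v w A hbot _ => ⟨_, hbot, hM.funMap_zero f _, hN.funMap_zero f _⟩⟩
    | 1, f =>
      obtain ⟨d, hd⟩ := ih 0
      refine ⟨d + 1, fun v w A hbot h => ?_⟩
      obtain ⟨p, hp, h₁, h₂⟩ := hd v w A hbot h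
      refine ⟨p, hp, ?_, ?_⟩
      · rw [Function.iterate_succ_apply', ← h₁]
        exact hM.funMap_succ f _
      · rw [Function.iterate_succ_apply', ← h₂]
        exact hN.funMap_succ f _

theorem exists_realize_term_le_iff (hM : IsDiscreteModel M) (hN : IsDiscreteModel N) {α : Type*}
    (s t : L0.Term α) : ∃ k : ℕ, ∀ (v : α → M) (w : α → N) (A : Set (M × N)), (⊥, ⊥) ∈ A →
      (∀ i, (v i, w i) ∈ A) → OrderAgree k A →
      ((s.realize v ≤ t.realize v ↔ s.realize w ≤ t.realize w) ∧
        (t.realize v ≤ s.realize v ↔ t.realize w ≤ s.realize w)) := by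
  obtain ⟨c, hc⟩ := exists_realize_term hM hN s
  obtain ⟨d, hd⟩ := exists_realize_term hM hN t
  refine ⟨max c d, fun v w A hbot h hA => ?_⟩
  obtain ⟨p, hp, hs, hs'⟩ := hc v w A hbot h
  obtain ⟨q, hq, ht, ht'⟩ := hd v w A hbot h
  rw [hs, hs', ht, ht']
  exact ⟨hA p hp q hq c (le_max_left ..) d (le_max_right ..),
    hA q hq p hp d (le_max_right ..) c (le_max_left ..)⟩

variable [NoMaxOrder M] [NoMaxOrder N]

theorem exists_realize_iff (hM : IsDiscreteModel M) (hN : IsDiscreteModel N) {α : Type*} {n : ℕ}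
    (φ : L0.BoundedFormula α n) : ∃ k : ℕ, ∀ (v : α → M) (w : α → N) (xs : Fin n → M)
      (ys : Fin n → N) (A : Set (M × N)), A.Finite → (⊥, ⊥) ∈ A → (∀ i, (v i, w i) ∈ A) →
      (∀ i, (xs i, ys i) ∈ A) → OrderAgree k A → (φ.Realize v xs ↔ φ.Realize w ys) := by
  induction φ with
  | falsum => exact ⟨0, fun _ _ _ _ _ _ _ _ _ _ => Iff.rfl⟩
  | equal s t =>
    obtain ⟨k, hk⟩ := exists_realize_term_le_iff hM hN s t
    refine ⟨k, fun v w xs ys A _ hbot hv hx hA => ?_⟩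
    obtain ⟨h₁, h₂⟩ := hk (Sum.elim v xs) (Sum.elim w ys) A hbot (Sum.forall.2 ⟨hv, hx⟩) hA
    exact le_antisymm_iff.trans ((and_congr h₁ h₂).trans le_antisymm_iff.symm)
  | @rel n l r ts =>
    match l, r with
    | 2, r =>
      obtain ⟨k, hk⟩ := exists_realize_term_le_iff hM hN (ts 0) (ts 1)
      refine ⟨k, fun v w xs ys A _ hbot hv hx hA => ?_⟩
      obtain ⟨-, h⟩ := hk (Sum.elim v xs) (Sum.elim w ys) A hbot (Sum.forall.2 ⟨hv, hx⟩) hA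
      refine (hM.relMap_lt r _).trans (Iff.trans ?_ (hN.relMap_lt r _).symm)
      simpa only [not_le] using h.not
  | imp φ ψ ihφ ihψ =>
    obtain ⟨k, hk⟩ := ihφ
    obtain ⟨l, hl⟩ := ihψ
    refine ⟨max k l, fun v w xs ys A hfin hbot hv hx hA => ?_⟩
    exact imp_congr (hk v w xs ys A hfin hbot hv hx (hA.mono (le_max_left ..)))
      (hl v w xs ys A hfin hbot hv hx (hA.mono (le_max_right ..)))
  | @all n φ ih =>
    obtain ⟨k, hk⟩ := ih
    refine ⟨2 * k + 1, fun v w xs ys A hfin hbot hv hx hA => ?_⟩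
    have snoc (a : M) (b : N) (hab : OrderAgree k (insert (a, b) A)) :
        φ.Realize v (Fin.snoc xs a) ↔ φ.Realize w (Fin.snoc ys b) := by
      refine hk _ _ _ _ _ (hfin.insert _) (Or.inr hbot) (fun i => Or.inr (hv i))
        (Fin.lastCases ?_ fun i => ?_) hab
      · simp
      · simpa using Or.inr (hx i)
    constructor
    · intro h b
      obtain ⟨a, ha⟩ := hA.swap.exists_insert hM.exists_succ_eq (hfin.image _) ⟨_, hbot, rfl⟩ b
      exact (snoc a b ha.of_swap).1 (h a)
    · intro h a
      obtain ⟨b, hb⟩ := hA.exists_insert hN.exists_succ_eq hfin hbot a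
      exact (snoc a b hb).2 (h b)

theorem realize_sentence_iff (hM : IsDiscreteModel M) (hN : IsDiscreteModel N)
    (φ : L0.Sentence) : M ⊨ φ ↔ N ⊨ φ := by
  obtain ⟨k, hk⟩ := exists_realize_iff hM hN φ
  refine hk _ _ _ _ {(⊥, ⊥)} (Set.finite_singleton _) rfl (fun i => i.elim)
    (fun i => i.elim0) ?_
  rintro p rfl q rfl c - d -
  simp only [iterate_succ_le_iterate_succ_self_iff]

end IsDiscreteModel

theorem isDiscreteModel_nat : IsDiscreteModel ℕ where
  funMap_zero _ _ := rfl
  funMap_succ _ _ := rfl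
  relMap_lt _ _ := Iff.rfl
  exists_succ_eq x hx := ⟨x - 1, Nat.succ_pred_eq_of_ne_zero hx⟩

section Symbols

variable {M : Type*} [L0.Structure M]

/-- The interpretation of `0` in an `L0`-structure. -/
def zeroVal (M : Type*) [L0.Structure M] : M :=
  Structure.funMap (L := L0) (n := 0) Unit.unit ![]

/-- The interpretation of `S` in an `L0`-structure. -/
def succVal (x : M) : M :=
  Structure.funMap (L := L0) (n := 1) Unit.unit ![x]

/-- The interpretation of `<` in an `L0`-structure. -/
def ltVal (x y : M) : Prop :=
  Structure.RelMap (L := L0) (n := 2) Unit.unit ![x, y]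

theorem realize_zeroT {α : Type} (v : α → M) : zeroT.realize v = zeroVal M :=
  congrArg (Structure.funMap (L := L0) (n := 0) Unit.unit) (Subsingleton.elim _ _)

theorem realize_succT {α : Type} (t : L0.Term α) (v : α → M) :
    (succT t).realize v = succVal (t.realize v) :=
  Term.realize_functions_apply₁

theorem realize_ltF {n : ℕ} (t₁ t₂ : L0.Term (Empty ⊕ Fin n)) (v : Empty → M) (xs : Fin n → M) :
    (ltF t₁ t₂).Realize v xs ↔
      ltVal (t₁.realize (Sum.elim v xs)) (t₂.realize (Sum.elim v xs)) :=
  BoundedFormula.realize_rel₂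

end Symbols

theorem exists_isDiscreteModel {M : Type*} [L0.Structure M] (h : M ⊨ AW) :
    ∃ (_ : LinearOrder M) (_ : OrderBot M) (_ : SuccOrder M) (_ : NoMaxOrder M),
      IsDiscreteModel M := by
  have hirr : ∀ x : M, ¬ ltVal x x := by
    have : M ⊨ axIrrefl := h.realize_of_mem _ (by simp [AW])
    simpa [axIrrefl, realize_ltF, Sentence.Realize, Formula.Realize,
      Fin.snoc] using this
  have htrans : ∀ x y z : M, ltVal x y → ltVal y z → ltVal x z := by
    have : M ⊨ axTrans := h.realize_of_mem _ (by simp [AW])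
    simpa [axTrans, realize_ltF, Sentence.Realize, Formula.Realize,
      Fin.snoc] using this
  have htot : ∀ x y : M, (ltVal x y ∨ x = y) ∨ ltVal y x := by
    have : M ⊨ axTotal := h.realize_of_mem _ (by simp [AW])
    simpa [axTotal, realize_ltF, Sentence.Realize, Formula.Realize,
      Fin.snoc] using this
  have hzero : ∀ x : M, ¬ ltVal x (zeroVal M) := by
    have : M ⊨ axZero := h.realize_of_mem _ (by simp [AW])
    simpa [axZero, realize_ltF, realize_zeroT, Sentence.Realize, Formula.Realize,
      Fin.snoc] using this
  have hsucc : ∀ x : M, ltVal x (succVal x) ∧ ∀ y, ltVal x y → ¬ ltVal y (succVal x) := by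
    have : M ⊨ axSucc := h.realize_of_mem _ (by simp [AW])
    simpa [axSucc, realize_ltF, realize_succT, Sentence.Realize, Formula.Realize,
      Fin.snoc] using this
  have hpred : ∀ x : M, x ≠ zeroVal M → ∃ y, succVal y = x := by
    have : M ⊨ axPred := h.realize_of_mem _ (by simp [AW])
    simpa [axPred, realize_succT, realize_zeroT, Sentence.Realize, Formula.Realize,
      Fin.snoc] using this
  let _ : LinearOrder M :=
    { le := fun x y => ¬ ltVal y x
      lt := ltVal
      le_refl := hirr
      le_trans := by grind
      le_antisymm := by grind
      lt_iff_le_not_ge := by grind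
      le_total := by grind
      toDecidableLE := Classical.decRel _ }
  let _ : OrderBot M := { bot := zeroVal M, bot_le := hzero }
  let _ : SuccOrder M := SuccOrder.ofSuccLeIff succVal fun {x y} => by
    change ¬ ltVal y (succVal x) ↔ ltVal x y
    grind
  have : NoMaxOrder M := ⟨fun x => ⟨succVal x, (hsucc x).1⟩⟩
  refine ⟨_, ‹_›, ‹_›, this, ?_, ?_, ?_, hpred⟩
  · intro f x
    rw [Subsingleton.elim x (![])]
    rfl
  · intro f x
    rw [show x = ![x 0] from funext fun i => by rw [Subsingleton.elim i 0]; rfl]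
    rfl
  · intro r x
    rw [show x = ![x 0, x 1] from funext fun i => by fin_cases i <;> rfl]
    rfl

/-- The finite theory `A_W` axiomatizes the complete theory of `𝔑`: for every
`L₀`-sentence `φ`, every model of `A_W` satisfies `φ` if and only if `𝔑 ⊨ φ`. -/
theorem AW_axiomatizes_theory_of_nat :
    ∀ (M : Type) [L0.Structure M], M ⊨ AW → ∀ φ : L0.Sentence, (M ⊨ φ) ↔ (ℕ ⊨ φ) := by
  intro M _ h φ
  obtain ⟨_, _, _, _, hM⟩ := exists_isDiscreteModel h
  exact hM.realize_sentence_iff isDiscreteModel_nat φ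
end
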